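/- arXiv:1406.5573 — 2 statements merged into one kernel-verified Lean document; each statement's English description precedes it below -/
import Mathlib

section
/- Let n ∈ ℕ and let A, B ⊆ ℝ^{n+2} be disjoint subsets. Consider the continuous maps β₁, γ₁ : ΣA × B → ℝ^{n+3} given by β₁((t, v), b) = (t, v − b) and γ₁((t, v), b) = (t, v − (1−|t|)·b). Then β₁ and γ₁ take values in ℝ^{n+3} ∖ {0} and are homotopic in ℝ^{n+3} ∖ {0}; that is, there exists a continuous map H : [0,1] × (ΣA × B) → ℝ^{n+3} ∖ {0} with H(0, ·) = β₁ and H(1, ·) = γ₁. -/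
/-- `ℝ^{n+2}` as Euclidean space. -/
abbrev Euc (n : ℕ) := EuclideanSpace ℝ (Fin (n + 2))

/-- The suspension `ΣA ⊆ ℝ × ℝ^{n+2}` of a subset `A ⊆ ℝ^{n+2}`:
`ΣA = {(t, (1-|t|)·a) : t ∈ [-1,1], a ∈ A}`. -/
def susp (n : ℕ) (A : Set (Euc n)) : Set (ℝ × Euc n) :=
  {p | ∃ t ∈ Set.Icc (-1 : ℝ) 1, ∃ a ∈ A, p = (t, (1 - |t|) • a)}

/-- Every map `((t, v), b) ↦ (t, v - (1 - s * |t|) • b)` avoids the origin on `ΣA × B`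
when `A` and `B` are disjoint. -/
theorem susp_sub_smul_ne_zero {n : ℕ} {A B : Set (Euc n)} (hAB : Disjoint A B) (s : ℝ)
    {p : ℝ × Euc n} (hp : p ∈ susp n A) {b : Euc n} (hb : b ∈ B) :
    ((p.1, p.2 - (1 - s * |p.1|) • b) : ℝ × Euc n) ≠ 0 := by
  obtain ⟨t, -, a, ha, rfl⟩ := hp
  intro h
  obtain ⟨rfl, h⟩ := Prod.mk_eq_zero.mp h
  have hab : a = b := by simpa [sub_eq_zero] using h
  exact hAB.ne_of_mem ha hb hab

theorem stmt_5 (n : ℕ) (A B : Set (Euc n)) (hAB : Disjoint A B) :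
    -- β₁ takes values in ℝ^{n+3} ∖ {0}
    (∀ p ∈ susp n A, ∀ b ∈ B, ((p.1, p.2 - b) : ℝ × Euc n) ≠ 0) ∧
    -- γ₁ takes values in ℝ^{n+3} ∖ {0}
    (∀ p ∈ susp n A, ∀ b ∈ B, ((p.1, p.2 - (1 - |p.1|) • b) : ℝ × Euc n) ≠ 0) ∧
    -- β₁ and γ₁ are homotopic in ℝ^{n+3} ∖ {0}
    ∃ H : Set.Icc (0 : ℝ) 1 × {x : (ℝ × Euc n) × Euc n // x.1 ∈ susp n A ∧ x.2 ∈ B} →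
        {y : ℝ × Euc n // y ≠ 0},
      Continuous H ∧
      (∀ x, (H (⟨0, Set.left_mem_Icc.mpr zero_le_one⟩, x) : ℝ × Euc n) =
        ((x : (ℝ × Euc n) × Euc n).1.1,
         (x : (ℝ × Euc n) × Euc n).1.2 - (x : (ℝ × Euc n) × Euc n).2)) ∧
      (∀ x, (H (⟨1, Set.right_mem_Icc.mpr zero_le_one⟩, x) : ℝ × Euc n) =
        ((x : (ℝ × Euc n) × Euc n).1.1,
         (x : (ℝ × Euc n) × Euc n).1.2 -
           (1 - |(x : (ℝ × Euc n) × Euc n).1.1|) • (x : (ℝ × Euc n) × Euc n).2)) := by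
  refine ⟨fun p hp b hb => ?_, fun p hp b hb => ?_,
    fun x => ⟨(x.2.1.1.1, x.2.1.1.2 - (1 - x.1.1 * |x.2.1.1.1|) • x.2.1.2),
      susp_sub_smul_ne_zero hAB x.1.1 x.2.2.1 x.2.2.2⟩, ?_, fun x => ?_, fun x => ?_⟩
  · simpa using susp_sub_smul_ne_zero hAB 0 hp hb
  · simpa using susp_sub_smul_ne_zero hAB 1 hp hb
  · exact Continuous.subtype_mk (by fun_prop) _
  · simp
  · simp
end

section
/- Let n ∈ ℕ and let A, B ⊆ ℝ^{n+2} be disjoint subsets. Consider the maps β, γ : ΣA × ΣB → ℝ × ℝ × ℝ^{n+2} given by β((t, v), (u, w)) = (t, u, v − w) and γ((t, v), (u, w)) = (t, u, (1−|u|)·v − (1−|t|)·w). Then β and γ take values in ℝ^{n+4} ∖ {0} and are homotopic in ℝ^{n+4} ∖ {0}; that is, there exists a continuous map H : [0,1] × (ΣA × ΣB) → ℝ^{n+4} ∖ {0} with H(0, ·) = β and H(1, ·) = γ. -/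
/-- `β((t,v),(u,w)) = (t, u, v - w)`. -/
noncomputable def betaMap (n : ℕ) (x : (ℝ × Euc n) × (ℝ × Euc n)) : ℝ × ℝ × Euc n :=
  (x.1.1, x.2.1, x.1.2 - x.2.2)

/-- `γ((t,v),(u,w)) = (t, u, (1-|u|)·v - (1-|t|)·w)`. -/
noncomputable def gammaMap (n : ℕ) (x : (ℝ × Euc n) × (ℝ × Euc n)) : ℝ × ℝ × Euc n :=
  (x.1.1, x.2.1, (1 - |x.2.1|) • x.1.2 - (1 - |x.1.1|) • x.2.2)

/-- The straight-line homotopy from `betaMap` to `gammaMap`. -/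
noncomputable def betaGammaHomotopy (n : ℕ) (s : ℝ) (x : (ℝ × Euc n) × (ℝ × Euc n)) :
    ℝ × ℝ × Euc n :=
  (x.1.1, x.2.1, (1 - s * |x.2.1|) • x.1.2 - (1 - s * |x.1.1|) • x.2.2)

theorem betaGammaHomotopy_zero (n : ℕ) (x : (ℝ × Euc n) × (ℝ × Euc n)) :
    betaGammaHomotopy n 0 x = betaMap n x := by
  simp [betaGammaHomotopy, betaMap]

theorem betaGammaHomotopy_one (n : ℕ) (x : (ℝ × Euc n) × (ℝ × Euc n)) :
    betaGammaHomotopy n 1 x = gammaMap n x := by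
  simp [betaGammaHomotopy, gammaMap]

theorem continuous_betaGammaHomotopy (n : ℕ) :
    Continuous fun z : ℝ × ((ℝ × Euc n) × (ℝ × Euc n)) => betaGammaHomotopy n z.1 z.2 := by
  unfold betaGammaHomotopy
  fun_prop

theorem betaGammaHomotopy_ne_zero {n : ℕ} {A B : Set (Euc n)} (hAB : Disjoint A B) (s : ℝ)
    {p q : ℝ × Euc n} (hp : p ∈ susp n A) (hq : q ∈ susp n B) :
    betaGammaHomotopy n s (p, q) ≠ 0 := by
  obtain ⟨t, -, a, ha, rfl⟩ := hp
  obtain ⟨u, -, b, hb, rfl⟩ := hq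
  intro h
  simp only [betaGammaHomotopy, Prod.mk_eq_zero] at h
  obtain ⟨rfl, rfl, h⟩ := h
  exact hAB.ne_of_mem ha hb (by simpa [sub_eq_zero] using h)

theorem stmt_6 (n : ℕ) (A B : Set (Euc n)) (hAB : Disjoint A B) :
    -- β takes values in ℝ^{n+4} ∖ {0}
    (∀ p ∈ susp n A, ∀ q ∈ susp n B, betaMap n (p, q) ≠ 0) ∧
    -- γ takes values in ℝ^{n+4} ∖ {0}
    (∀ p ∈ susp n A, ∀ q ∈ susp n B, gammaMap n (p, q) ≠ 0) ∧
    -- β and γ are homotopic in ℝ^{n+4} ∖ {0}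
    ∃ H : Set.Icc (0 : ℝ) 1 ×
        {x : (ℝ × Euc n) × (ℝ × Euc n) // x.1 ∈ susp n A ∧ x.2 ∈ susp n B} →
        {y : ℝ × ℝ × Euc n // y ≠ 0},
      Continuous H ∧
      (∀ x, (H (⟨0, Set.left_mem_Icc.mpr zero_le_one⟩, x) : ℝ × ℝ × Euc n) =
        betaMap n x) ∧
      (∀ x, (H (⟨1, Set.right_mem_Icc.mpr zero_le_one⟩, x) : ℝ × ℝ × Euc n) =
        gammaMap n x) := by
  refine ⟨fun p hp q hq => ?_, fun p hp q hq => ?_,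
    fun z => ⟨betaGammaHomotopy n z.1 z.2,
      betaGammaHomotopy_ne_zero hAB z.1 z.2.2.1 z.2.2.2⟩, ?_,
    fun x => betaGammaHomotopy_zero n x, fun x => betaGammaHomotopy_one n x⟩
  · rw [← betaGammaHomotopy_zero]
    exact betaGammaHomotopy_ne_zero hAB 0 hp hq
  · rw [← betaGammaHomotopy_one]
    exact betaGammaHomotopy_ne_zero hAB 1 hp hq
  · exact ((continuous_betaGammaHomotopy n).comp
      (continuous_subtype_val.prodMap continuous_subtype_val)).subtype_mk _
end
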